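/- Suppose v : B → ℝ is a function on the unit cube B such that for every α ∈ Zⁿ = {0,1}ⁿ the mixed partial derivative D^α v exists and is twice continuously differentiable on B. Then for any ε > 0, there exists a polynomial p in n variables such that for every α ∈ Zⁿ and every x ∈ B with x ≠ 0, |D^α p(x) − D^α v(x)| ≤ ε · xᵀx. -/

import Mathlib

/-- The unit cube `B = {x ∈ ℝⁿ : ‖x‖_∞ ≤ 1}`. -/
def cubeB (n : ℕ) : Set (Fin n → ℝ) := {x | ∀ i, |x i| ≤ 1}

/-- The squared Euclidean norm `xᵀx = ∑ₖ x_k²`. -/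
def sqnorm (n : ℕ) (x : Fin n → ℝ) : ℝ := ∑ k, x k ^ 2

/-- The partial derivative `∂f/∂x_i`, as the derivative of the one-variable slice. -/
noncomputable def pd (n : ℕ) (i : Fin n) (f : (Fin n → ℝ) → ℝ) : (Fin n → ℝ) → ℝ :=
  fun x => deriv (fun t : ℝ => f (Function.update x i t)) (x i)

/-- The mixed partial derivative `D^α f = ∂^α f / ∂x^α` for a multi-index `α ∈ ℕⁿ`. -/
noncomputable def Dmix (n : ℕ) (α : Fin n → ℕ) (f : (Fin n → ℝ) → ℝ) :
    (Fin n → ℝ) → ℝ :=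
  (List.finRange n).foldr (fun i g => (pd n i)^[α i] g) f

/-- `Zⁿ = {α ∈ ℕⁿ : α_i ∈ {0,1}}`. -/
def Zn (n : ℕ) : Finset (Fin n → ℕ) := Fintype.piFinset fun _ => ({0, 1} : Finset ℕ)

open MvPolynomial

section Antiderivative

variable {σ : Type*}

/-- The antiderivative of a polynomial in the variable `i` that vanishes on `x i = 0`. -/
noncomputable def antideriv (i : σ) : MvPolynomial σ ℝ →ₗ[ℝ] MvPolynomial σ ℝ :=
  (basisMonomials σ ℝ).constr ℝ fun s =>
    monomial (s + Finsupp.single i 1) (((s i : ℝ) + 1)⁻¹)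

theorem antideriv_monomial (i : σ) (s : σ →₀ ℕ) (a : ℝ) :
    antideriv i (monomial s a) =
      monomial (s + Finsupp.single i 1) (a * ((s i : ℝ) + 1)⁻¹) := by
  have h : monomial s a = a • basisMonomials σ ℝ s := by simp [smul_monomial]
  rw [h, map_smul, antideriv, Module.Basis.constr_basis, smul_monomial, smul_eq_mul]

theorem pderiv_antideriv (i : σ) (p : MvPolynomial σ ℝ) : pderiv i (antideriv i p) = p := by
  induction p using MvPolynomial.induction_on' with
  | monomial s a =>
    have h : (s i : ℝ) + 1 ≠ 0 := by positivity
    rw [antideriv_monomial, pderiv_monomial, add_tsub_cancel_right]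
    congr 1
    simp [h]
  | add p q hp hq => rw [map_add, map_add, hp, hq]

theorem pderiv_antideriv_of_ne {i j : σ} (hij : i ≠ j) (p : MvPolynomial σ ℝ) :
    pderiv j (antideriv i p) = antideriv i (pderiv j p) := by
  classical
  induction p using MvPolynomial.induction_on' with
  | monomial s a =>
    rw [antideriv_monomial, pderiv_monomial, pderiv_monomial, antideriv_monomial]
    have h₁ : (s - Finsupp.single j 1 : σ →₀ ℕ) i = s i := by simp [hij.symm]
    have h₂ : (s + Finsupp.single i 1 : σ →₀ ℕ) j = s j := by simp [hij]
    have h₃ : s + Finsupp.single i 1 - Finsupp.single j 1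
        = s - Finsupp.single j 1 + Finsupp.single i 1 := by
      ext k
      simp only [Finsupp.coe_tsub, Finsupp.coe_add, Pi.sub_apply, Pi.add_apply,
        Finsupp.single_apply]
      by_cases hik : i = k <;> by_cases hjk : j = k <;> simp_all
    rw [h₁, h₂, h₃]
    congr 1
    ring
  | add p q hp hq => simp only [map_add, hp, hq]

theorem eval_antideriv_of_eq_zero (i : σ) (p : MvPolynomial σ ℝ) {x : σ → ℝ} (hx : x i = 0) :
    eval x (antideriv i p) = 0 := by
  classical
  induction p using MvPolynomial.induction_on' with
  | monomial s a =>
    rw [antideriv_monomial, monomial_add_single]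
    simp [hx]
  | add p q hp hq => simp only [map_add, hp, hq, add_zero]

theorem pderiv_comm (i j : σ) (p : MvPolynomial σ ℝ) :
    pderiv i (pderiv j p) = pderiv j (pderiv i p) := by
  by_cases hij : i = j
  · rw [hij]
  have h : ⁅(pderiv i : Derivation ℝ (MvPolynomial σ ℝ) (MvPolynomial σ ℝ)),
      (pderiv j : Derivation ℝ (MvPolynomial σ ℝ) (MvPolynomial σ ℝ))⁆ = 0 := by
    classical
    apply derivation_ext
    intro k
    rw [Derivation.commutator_apply, pderiv_X, pderiv_X]
    simp only [Pi.single_apply]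
    split_ifs <;> simp
  have := congrArg (fun D => D p) h
  simpa [Derivation.commutator_apply, sub_eq_zero] using this

theorem hasDerivAt_eval_update [DecidableEq σ] (p : MvPolynomial σ ℝ) (x : σ → ℝ) (i : σ) (t : ℝ) :
    HasDerivAt (fun s => eval (Function.update x i s) p)
      (eval (Function.update x i t) (pderiv i p)) t := by
  induction p using MvPolynomial.induction_on with
  | C a => simpa using hasDerivAt_const t a
  | add p q hp hq =>
    simp only [map_add]
    exact hp.add hq
  | mul_X p j hp =>
    have hX : HasDerivAt (fun s => Function.update x i s j)
        (eval (Function.update x i t) (pderiv i (X j : MvPolynomial σ ℝ))) t := by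
      by_cases hij : j = i
      · subst hij
        simp only [Function.update_self, pderiv_X_self, map_one]
        exact hasDerivAt_id' t
      · simpa [hij, pderiv_X_of_ne hij] using hasDerivAt_const t (x j)
    have h := hp.mul hX
    simp only [map_mul, eval_X, pderiv_mul, map_add]
    exact h

/-- The mixed partial derivative of a polynomial with respect to the variables in a list. -/
noncomputable def listPderiv (l : List σ) (α : σ → ℕ) (p : MvPolynomial σ ℝ) : MvPolynomial σ ℝ :=
  l.foldr (fun i q => (pderiv i)^[α i] q) p

theorem listPderiv_cons (i : σ) (l : List σ) (α : σ → ℕ) (p : MvPolynomial σ ℝ) :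
    listPderiv (i :: l) α p = (pderiv i)^[α i] (listPderiv l α p) := rfl

theorem listPderiv_congr {l : List σ} {α β : σ → ℕ} (h : ∀ i ∈ l, α i = β i)
    (p : MvPolynomial σ ℝ) : listPderiv l α p = listPderiv l β p := by
  induction l with
  | nil => rfl
  | cons i l ih =>
    rw [listPderiv_cons, listPderiv_cons, h i (by simp),
      ih fun j hj => h j (List.mem_cons_of_mem _ hj)]

theorem listPderiv_add (l : List σ) (α : σ → ℕ) (p q : MvPolynomial σ ℝ) :
    listPderiv l α (p + q) = listPderiv l α p + listPderiv l α q := by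
  induction l with
  | nil => rfl
  | cons i l ih => rw [listPderiv_cons, ih, iterate_map_add, listPderiv_cons, listPderiv_cons]

theorem listPderiv_sub (l : List σ) (α : σ → ℕ) (p q : MvPolynomial σ ℝ) :
    listPderiv l α (p - q) = listPderiv l α p - listPderiv l α q := by
  rw [eq_sub_iff_add_eq, ← listPderiv_add, sub_add_cancel]

theorem listPderiv_pderiv (l : List σ) (α : σ → ℕ) (i : σ) (p : MvPolynomial σ ℝ) :
    listPderiv l α (pderiv i p) = pderiv i (listPderiv l α p) := by
  induction l with
  | nil => rfl
  | cons j l ih =>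
    rw [listPderiv_cons, ih, listPderiv_cons]
    exact ((Function.Commute.iterate_right (f := pderiv i) (g := pderiv j)
      (fun q => pderiv_comm i j q) (α j)) _).symm

theorem listPderiv_antideriv {l : List σ} (α : σ → ℕ) {i : σ} (hi : i ∉ l)
    (p : MvPolynomial σ ℝ) : listPderiv l α (antideriv i p) = antideriv i (listPderiv l α p) := by
  induction l with
  | nil => rfl
  | cons j l ih =>
    simp only [List.mem_cons, not_or] at hi
    rw [listPderiv_cons, ih hi.2, listPderiv_cons]
    exact ((Function.Commute.iterate_right (f := antideriv i) (g := pderiv j)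
      (fun q => (pderiv_antideriv_of_ne hi.1 q).symm) (α j)) _).symm

end Antiderivative

theorem pd_eval (n : ℕ) (i : Fin n) (p : MvPolynomial (Fin n) ℝ) :
    pd n i (fun y => eval y p) = fun y => eval y (pderiv i p) := by
  funext x
  simpa [pd] using (hasDerivAt_eval_update p x i (x i)).deriv

theorem Dmix_eval (n : ℕ) (α : Fin n → ℕ) (p : MvPolynomial (Fin n) ℝ) :
    Dmix n α (fun y => eval y p) = fun y => eval y (listPderiv (List.finRange n) α p) := by
  have hiter : ∀ (i : Fin n) (k : ℕ) (q : MvPolynomial (Fin n) ℝ),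
      (pd n i)^[k] (fun y => eval y q) = fun y => eval y ((pderiv i)^[k] q) := by
    intro i k
    induction k with
    | zero => intro q; rfl
    | succ k ih => intro q; rw [Function.iterate_succ_apply, pd_eval, ih,
        Function.iterate_succ_apply]
  unfold Dmix listPderiv
  induction List.finRange n with
  | nil => rfl
  | cons i l ih => simp only [List.foldr_cons, ih, hiter]

theorem mem_Zn {n : ℕ} {α : Fin n → ℕ} : α ∈ Zn n ↔ ∀ i, α i = 0 ∨ α i = 1 := by
  simp [Zn, Fintype.mem_piFinset]

theorem update_mem_Zn {n : ℕ} {α : Fin n → ℕ} (hα : α ∈ Zn n) (i : Fin n) {k : ℕ}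
    (hk : k = 0 ∨ k = 1) : Function.update α i k ∈ Zn n := by
  rw [mem_Zn] at hα ⊢
  intro j
  by_cases hj : j = i
  · subst hj; simpa using hk
  · simpa [hj] using hα j

theorem sqnorm_nonneg (n : ℕ) (x : Fin n → ℝ) : 0 ≤ sqnorm n x :=
  Finset.sum_nonneg fun _ _ => sq_nonneg _

theorem sqnorm_update_le {n : ℕ} (x : Fin n → ℝ) {i : Fin n} {t : ℝ} (ht : |t| ≤ |x i|) :
    sqnorm n (Function.update x i t) ≤ sqnorm n x := by
  apply Finset.sum_le_sum
  intro k _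
  by_cases hk : k = i
  · subst hk; simpa using sq_le_sq.2 ht
  · simp [hk]

theorem norm_sq_le_sqnorm {n : ℕ} (x : Fin n → ℝ) : ‖x‖ ^ 2 ≤ sqnorm n x := by
  rw [← Real.le_sqrt (norm_nonneg _) (sqnorm_nonneg n x),
    pi_norm_le_iff_of_nonneg (Real.sqrt_nonneg _)]
  intro i
  rw [Real.le_sqrt (norm_nonneg _) (sqnorm_nonneg n x), Real.norm_eq_abs, sq_abs]
  exact Finset.single_le_sum (f := fun k => x k ^ 2) (fun _ _ => sq_nonneg _) (Finset.mem_univ i)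

theorem sqnorm_pos {n : ℕ} {x : Fin n → ℝ} (hx : x ≠ 0) : 0 < sqnorm n x :=
  lt_of_lt_of_le (pow_pos (norm_pos_iff.2 hx) 2) (norm_sq_le_sqnorm x)

/-- `f` can be approximated on `D` by polynomials, with error small relative to `xᵀx`. -/
def ApproxOn (n : ℕ) (D : Set (Fin n → ℝ)) (f : (Fin n → ℝ) → ℝ) : Prop :=
  ∀ ε : ℝ, 0 < ε → ∃ q : MvPolynomial (Fin n) ℝ, ∀ x ∈ D, |eval x q - f x| ≤ ε * sqnorm n x

/-- If every member of a family of mixed partial derivatives is approximable by polynomials, then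
all of them are approximated simultaneously by the derivatives of a single polynomial. -/
theorem exists_listPderiv_approx {n : ℕ} (l : List (Fin n)) (hl : l.Nodup)
    (D : Set (Fin n → ℝ)) (hDcube : D ⊆ cubeB n)
    (hD : ∀ x ∈ D, ∀ i ∈ l, ∀ t : ℝ, |t| ≤ |x i| → Function.update x i t ∈ D)
    (F : (Fin n → ℕ) → (Fin n → ℝ) → ℝ) (hF : ∀ α ∈ Zn n, ApproxOn n D (F α))
    (hder : ∀ α ∈ Zn n, ∀ i ∈ l, α i = 0 → ∀ x ∈ D,
      HasDerivAt (fun t : ℝ => F α (Function.update x i t)) (F (Function.update α i 1) x) (x i))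
    (ε : ℝ) (hε : 0 < ε) :
    ∃ p : MvPolynomial (Fin n) ℝ, ∀ α ∈ Zn n, (∀ j, j ∉ l → α j = 0) → ∀ x ∈ D,
      |eval x (listPderiv l α p) - F α x| ≤ ε * sqnorm n x := by
  induction l generalizing D F ε with
  | nil =>
    obtain ⟨q, hq⟩ := hF 0 (mem_Zn.2 fun _ => Or.inl rfl) ε hε
    refine ⟨q, fun α _ hα x hx => ?_⟩
    obtain rfl : α = 0 := funext fun j => hα j (by simp)
    exact hq x hx
  | cons i l ih =>
    obtain ⟨hi, hl⟩ := List.nodup_cons.1 hl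
    have hne : ∀ j ∈ l, j ≠ i := fun j hj h => hi (h ▸ hj)
    obtain ⟨q, hq⟩ := ih hl D hDcube
      (fun x hx j hj => hD x hx j (List.mem_cons_of_mem _ hj))
      (fun α => F (Function.update α i 1))
      (fun α hα => hF _ (update_mem_Zn hα i (Or.inr rfl)))
      (fun α hα j hj hαj x hx => by
        rw [Function.update_comm (hne j hj)]
        exact hder _ (update_mem_Zn hα i (Or.inr rfl)) j (List.mem_cons_of_mem _ hj)
          (by simpa [hne j hj] using hαj) x hx)
      (ε / 2) (half_pos hε)
    obtain ⟨r, hr⟩ := ih hl (D ∩ {x | x i = 0}) (Set.inter_subset_left.trans hDcube)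
      (fun x hx j hj t ht => ⟨hD x hx.1 j (List.mem_cons_of_mem _ hj) t ht, by
        simpa [(hne j hj).symm] using hx.2⟩)
      F
      (fun α hα δ hδ => (hF α hα δ hδ).imp fun _ h x hx => h x hx.1)
      (fun α hα j hj hαj x hx => hder α hα j (List.mem_cons_of_mem _ hj) hαj x hx.1)
      (ε / 2) (half_pos hε)
    set p := r + antideriv i (q - pderiv i r) with hp
    have hpα : ∀ α, listPderiv l α p =
        listPderiv l α r + antideriv i (listPderiv l α q - pderiv i (listPderiv l α r)) := by
      intro α
      rw [hp, listPderiv_add, listPderiv_antideriv α hi, listPderiv_sub, listPderiv_pderiv]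
    have hpd : ∀ α, pderiv i (listPderiv l α p) = listPderiv l α q := by
      intro α
      rw [hpα, map_add, pderiv_antideriv, add_sub_cancel]
    refine ⟨p, fun α hα hsupp x hx => ?_⟩
    rcases mem_Zn.1 hα i with hαi | hαi
    · have hsupp' : ∀ j, j ∉ l → α j = 0 := by
        intro j hj
        by_cases hji : j = i
        · rwa [hji]
        · exact hsupp j (by simp [hji, hj])
      rw [listPderiv_cons, hαi, Function.iterate_zero, id]
      have hmem : ∀ t ∈ Set.uIcc 0 (x i), |t| ≤ |x i| := fun t ht => by
        simpa using Set.abs_sub_left_of_mem_uIcc ht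
      have hmv := Convex.norm_image_sub_le_of_norm_hasDerivWithin_le (s := Set.uIcc 0 (x i))
        (f := fun t => eval (Function.update x i t) (listPderiv l α p) -
          F α (Function.update x i t))
        (f' := fun t => eval (Function.update x i t) (listPderiv l α q) -
          F (Function.update α i 1) (Function.update x i t))
        (C := ε / 2 * sqnorm n x) (x := 0) (y := x i)
        (fun t ht => by
          refine HasDerivAt.hasDerivWithinAt (HasDerivAt.sub ?_ ?_)
          · rw [← hpd]
            exact hasDerivAt_eval_update _ _ _ _
          · have := hder α hα i (by simp) hαi _ (hD x hx i (by simp) t (hmem t ht))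
            simpa using this)
        (fun t ht => by
          refine (hq α hα hsupp' _ (hD x hx i (by simp) t (hmem t ht))).trans ?_
          exact mul_le_mul_of_nonneg_left (sqnorm_update_le x (hmem t ht)) (half_pos hε).le)
        (convex_uIcc _ _) Set.left_mem_uIcc Set.right_mem_uIcc
      have h0 : |(0 : ℝ)| ≤ |x i| := by simp
      have hbase := hr α hα hsupp' (Function.update x i 0)
        ⟨hD x hx i (by simp) 0 h0, by simp⟩
      have hle := mul_le_mul_of_nonneg_left (sqnorm_update_le x h0) (half_pos hε).le
      have hev : eval (Function.update x i 0) (listPderiv l α p) =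
          eval (Function.update x i 0) (listPderiv l α r) := by
        rw [hpα, map_add, eval_antideriv_of_eq_zero i _ (by simp), add_zero]
      simp only [Function.update_eq_self, Real.norm_eq_abs, sub_zero, hev] at hmv
      have hxi : ε / 2 * sqnorm n x * |x i| ≤ ε / 2 * sqnorm n x :=
        mul_le_of_le_one_right (mul_nonneg (half_pos hε).le (sqnorm_nonneg n x)) (hDcube hx i)
      have htri := abs_sub_abs_le_abs_sub (eval x (listPderiv l α p) - F α x)
        (eval (Function.update x i 0) (listPderiv l α r) - F α (Function.update x i 0))
      linarith
    · have hq' := hq (Function.update α i 0) (update_mem_Zn hα i (Or.inl rfl))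
        (fun j hj => by
          by_cases hji : j = i
          · simp [hji]
          · simpa [hji] using hsupp j (by simp [hji, hj])) x hx
      have hcongr : listPderiv l (Function.update α i 0) q = listPderiv l α q :=
        listPderiv_congr (fun j hj => by simp [hne j hj]) q
      have hup : Function.update α i 1 = α := by rw [← hαi, Function.update_eq_self]
      rw [hcongr, Function.update_idem, hup] at hq'
      rw [listPderiv_cons, hαi, Function.iterate_one, hpd]
      refine hq'.trans (mul_le_mul_of_nonneg_right (half_le_self hε.le) (sqnorm_nonneg n x))

theorem isCompact_cubeB (n : ℕ) : IsCompact (cubeB n) := by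
  have h : cubeB n = Set.pi Set.univ fun _ => Set.Icc (-1 : ℝ) 1 := by
    ext x
    simp only [cubeB, abs_le, Set.mem_pi, Set.mem_univ, Set.mem_Icc, Set.mem_ofPred_eq,
      forall_true_left]
  rw [h]
  exact isCompact_univ_pi fun _ => isCompact_Icc

theorem cubeB_mem_nhds (n : ℕ) : cubeB n ∈ nhds (0 : Fin n → ℝ) := by
  refine Filter.mem_of_superset (Metric.closedBall_mem_nhds 0 one_pos) fun x hx i => ?_
  rw [mem_closedBall_zero_iff] at hx
  exact (norm_le_pi_norm x i).trans hx

theorem exists_mvPolynomial_near_of_continuousOn {n : ℕ} {K : Set (Fin n → ℝ)} (hK : IsCompact K)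
    {g : (Fin n → ℝ) → ℝ} (hg : ContinuousOn g K) {ε : ℝ} (hε : 0 < ε) :
    ∃ q : MvPolynomial (Fin n) ℝ, ∀ x ∈ K, |eval x q - g x| ≤ ε := by
  have : CompactSpace K := isCompact_iff_compactSpace.1 hK
  let φ : MvPolynomial (Fin n) ℝ →ₐ[ℝ] C(K, ℝ) :=
    aeval fun i => ⟨fun x => x.1 i, (continuous_apply i).comp continuous_subtype_val⟩
  have hφ : ∀ q (x : K), φ q x = eval x.1 q := by
    intro q x
    induction q using MvPolynomial.induction_on with
    | C a => simp [φ]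
    | add p q hp hq => simp [hp, hq]
    | mul_X p j hp => rw [map_mul, ContinuousMap.mul_apply, hp]; simp [φ]
  have hsep : φ.range.SeparatesPoints := by
    intro x y hxy
    obtain ⟨i, hi⟩ := Function.ne_iff.1 fun h => hxy (Subtype.ext h)
    exact ⟨_, ⟨φ (X i), ⟨X i, rfl⟩, rfl⟩, by simpa [hφ] using hi⟩
  obtain ⟨⟨g', hg'⟩, hq⟩ :=
    ContinuousMap.exists_mem_subalgebra_near_continuous_of_separatesPoints φ.range hsep
      (K.domRestrict g) hg.domRestrict ε hε
  obtain ⟨q, rfl⟩ := (AlgHom.mem_range φ).1 hg'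
  refine ⟨q, fun x hx => ?_⟩
  rw [← hφ q ⟨x, hx⟩]
  exact (hq ⟨x, hx⟩).le

theorem exists_polynomial_eq_clm {n : ℕ} (L : (Fin n → ℝ) →L[ℝ] ℝ) :
    ∃ q : MvPolynomial (Fin n) ℝ, ∀ x, eval x q = L x := by
  refine ⟨∑ i, X i * C (L (Pi.single i 1)), fun x => ?_⟩
  conv_rhs => rw [pi_eq_sum_univ' x]
  simp

theorem exists_polynomial_eq_bilin {n : ℕ}
    (Q : (Fin n → ℝ) →L[ℝ] (Fin n → ℝ) →L[ℝ] ℝ) :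
    ∃ q : MvPolynomial (Fin n) ℝ, ∀ x, eval x q = Q x x := by
  choose q hq using fun i => exists_polynomial_eq_clm (Q (Pi.single i 1))
  refine ⟨∑ i, X i * q i, fun x => ?_⟩
  have h : Q x = ∑ i, x i • Q (Pi.single i 1) := by
    conv_lhs => rw [pi_eq_sum_univ' x]
    simp
  rw [h]
  simp [hq]

/-- Second order Taylor expansion with Peano remainder. -/
theorem ContDiffAt.taylor_two_isLittleO {E : Type*} [NormedAddCommGroup E] [NormedSpace ℝ E]
    {f : E → ℝ} (hf : ContDiffAt ℝ 2 f 0) :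
    (fun x => f x - f 0 - fderiv ℝ f 0 x - 2⁻¹ * fderiv ℝ (fderiv ℝ f) 0 x x)
      =o[nhds 0] fun x => ‖x‖ ^ 2 := by
  set L := fderiv ℝ f 0
  set Q := fderiv ℝ (fderiv ℝ f) 0
  have hdiff : ∀ᶠ y in nhds (0 : E), DifferentiableAt ℝ f y := by
    filter_upwards [hf.eventually (by simp)] with y hy
    exact hy.differentiableAt (by norm_num)
  have hQ : HasFDerivAt (fderiv ℝ f) Q 0 :=
    ((hf.fderiv_right (m := 1) (by norm_num)).differentiableAt (by norm_num)).hasFDerivAt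
  rw [Asymptotics.isLittleO_iff]
  intro c hc
  have hQc := hQ.isLittleO.def hc
  obtain ⟨δ, hδ, hball⟩ := Metric.eventually_nhds_iff_ball.1 (hdiff.and hQc)
  filter_upwards [Metric.ball_mem_nhds (0 : E) hδ] with x hx
  rw [mem_ball_zero_iff] at hx
  have hle : ∀ t ∈ Set.Icc (0 : ℝ) 1, ‖t • x‖ ≤ ‖x‖ := by
    intro t ht
    rw [norm_smul, Real.norm_eq_abs, abs_of_nonneg ht.1]
    exact mul_le_of_le_one_left (norm_nonneg _) ht.2
  have hmv := Convex.norm_image_sub_le_of_norm_hasDerivWithin_le (s := Set.Icc (0 : ℝ) 1)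
    (f := fun t => f (t • x) - f 0 - t * L x - t ^ 2 * (2⁻¹ * Q x x))
    (f' := fun t => (fderiv ℝ f (t • x) - L - Q (t • x)) x)
    (C := c * ‖x‖ * ‖x‖) (x := 0) (y := 1)
    (fun t ht => by
      have hd := (hball (t • x) (by
        rw [mem_ball_zero_iff]; exact (hle t ht).trans_lt hx)).1.hasFDerivAt
      have hline : HasDerivAt (fun s : ℝ => s • x) x t := by
        simpa using (hasDerivAt_id t).smul_const x
      have h₁ := hd.comp_hasDerivAt t hline
      have h₂ := (hasDerivAt_id t).mul_const (L x)
      have h₃ := (hasDerivAt_pow 2 t).mul_const (2⁻¹ * Q x x)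
      have h := ((h₁.sub_const (f 0)).sub h₂).sub h₃
      refine (h.congr_deriv ?_).hasDerivWithinAt
      simp
      ring)
    (fun t ht => by
      have hb := (hball (t • x) (by
        rw [mem_ball_zero_iff]; exact (hle t ht).trans_lt hx)).2
      rw [sub_zero] at hb
      refine (ContinuousLinearMap.le_opNorm _ _).trans ?_
      refine mul_le_mul_of_nonneg_right (hb.trans ?_) (norm_nonneg _)
      exact mul_le_mul_of_nonneg_left (hle t ht) hc.le)
    (convex_Icc 0 1) (by simp) (by simp)
  simp only [one_smul, zero_smul, one_mul, one_pow, zero_mul, sub_self, sub_zero, norm_one,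
    mul_one, ne_eq, OfNat.ofNat_ne_zero, not_false_eq_true, zero_pow] at hmv
  rwa [norm_pow, norm_norm, pow_two, ← mul_assoc]

theorem approxOn_of_contDiffOn {n : ℕ} {f : (Fin n → ℝ) → ℝ}
    (hf : ContDiffOn ℝ 2 f (cubeB n)) : ApproxOn n (cubeB n) f := by
  intro ε hε
  obtain ⟨l, hl⟩ := exists_polynomial_eq_clm (fderiv ℝ f 0)
  obtain ⟨b, hb⟩ := exists_polynomial_eq_bilin (fderiv ℝ (fderiv ℝ f) 0)
  obtain ⟨s, hs⟩ : ∃ s : MvPolynomial (Fin n) ℝ, ∀ x, eval x s = sqnorm n x :=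
    ⟨∑ k, X k ^ 2, fun x => by simp [sqnorm]⟩
  set m := C (f 0) + l + C 2⁻¹ * b
  set r : (Fin n → ℝ) → ℝ := fun x => f x - eval x m with hr
  have hlittle : r =o[nhds 0] sqnorm n := by
    have h := (hf.contDiffAt (cubeB_mem_nhds n)).taylor_two_isLittleO
    refine (h.congr_left fun x => ?_).trans_isBigO (Asymptotics.IsBigO.of_bound 1 ?_)
    · simp only [hr, m, map_add, map_mul, eval_C, hl, hb]
      ring
    · refine Filter.Eventually.of_forall fun x => ?_
      rw [Real.norm_of_nonneg (by positivity), Real.norm_of_nonneg (sqnorm_nonneg n x), one_mul]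
      exact norm_sq_le_sqnorm x
  have hr0 : r 0 = 0 := by
    have h0 : sqnorm n 0 = 0 := by simp [sqnorm]
    have := (hlittle.def one_pos).self_of_nhds
    simpa [h0] using this
  have hscont : Continuous (sqnorm n) := by unfold sqnorm; fun_prop
  have hg : ContinuousOn (fun x => r x / sqnorm n x) (cubeB n) := by
    intro x hx
    by_cases hx0 : x = 0
    · subst hx0
      refine ContinuousAt.continuousWithinAt ?_
      have := hlittle.tendsto_div_nhds_zero
      rw [ContinuousAt, hr0, zero_div]
      exact this
    · exact ((hf.continuousOn x hx).sub (continuous_eval m).continuousWithinAt).div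
        hscont.continuousWithinAt (sqnorm_pos hx0).ne'
  obtain ⟨q, hq⟩ := exists_mvPolynomial_near_of_continuousOn (isCompact_cubeB n) hg hε
  refine ⟨m + q * s, fun x hx => ?_⟩
  have hrx : r x = r x / sqnorm n x * sqnorm n x := by
    by_cases hx0 : x = 0
    · rw [hx0, hr0]; simp
    · rw [div_mul_cancel₀ _ (sqnorm_pos hx0).ne']
  have hsplit : eval x (m + q * s) - f x = (eval x q - r x / sqnorm n x) * sqnorm n x := by
    rw [sub_mul, ← hrx, map_add, map_mul, hs]
    simp only [hr]
    ring
  rw [hsplit, abs_mul, abs_of_nonneg (sqnorm_nonneg n x)]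
  exact mul_le_mul_of_nonneg_right (hq x hx) (sqnorm_nonneg n x)

/-- suppose `v : B → ℝ` is such that for every `α ∈ Zⁿ = {0,1}ⁿ` the
mixed partial derivative `D^α v` exists and is twice continuously differentiable
on `B` (the family `{D^α v}` is encoded by `F`, with `F 0 = v` and `F (α + eᵢ)`
the partial derivative of `F α` in the `i`-th variable on `B`).  Then for any
`ε > 0` there is a polynomial `p` in `n` variables such that for every `α ∈ Zⁿ`
and every `x ∈ B` with `x ≠ 0`, `|D^α p(x) − D^α v(x)| ≤ ε · xᵀx`. -/
theorem poly_approx_weighted_W1inf (n : ℕ) (v : (Fin n → ℝ) → ℝ)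
    (F : (Fin n → ℕ) → (Fin n → ℝ) → ℝ) (hF0 : F 0 = v)
    (hder : ∀ α ∈ Zn n, ∀ i : Fin n, α i = 0 → ∀ x ∈ cubeB n,
      HasDerivAt (fun t : ℝ => F α (Function.update x i t))
        (F (α + Pi.single i 1) x) (x i))
    (hsmooth : ∀ α ∈ Zn n, ContDiffOn ℝ 2 (F α) (cubeB n))
    (ε : ℝ) (hε : 0 < ε) :
    ∃ p : MvPolynomial (Fin n) ℝ, ∀ α ∈ Zn n, ∀ x ∈ cubeB n, x ≠ 0 →
      |Dmix n α (fun y => MvPolynomial.eval y p) x - F α x| ≤ ε * sqnorm n x := by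
  have hadd : ∀ (α : Fin n → ℕ) (i : Fin n), α i = 0 →
      α + Pi.single i 1 = Function.update α i 1 := by
    intro α i hαi
    funext j
    by_cases hj : j = i
    · subst hj; simp [hαi]
    · simp [hj]
  obtain ⟨p, hp⟩ := exists_listPderiv_approx (List.finRange n) (List.nodup_finRange n) (cubeB n)
    subset_rfl
    (fun x hx i _ t ht j => by
      by_cases hj : j = i
      · subst hj; simpa using ht.trans (hx j)
      · simpa [hj] using hx j)
    F (fun α hα => approxOn_of_contDiffOn (hsmooth α hα))
    (fun α hα i _ hαi x hx => hadd α i hαi ▸ hder α hα i hαi x hx) ε hε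
  refine ⟨p, fun α hα x hx _ => ?_⟩
  rw [Dmix_eval]
  exact hp α hα (fun j hj => absurd (List.mem_finRange j) hj) x hx
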